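/- For every n ≥ 1, every δ with 0 ≤ δ < π/2, and all v, v′ ∈ {−1,1}ⁿ, the smallest eigenvalue of the Hermitian matrix H_v^δ + H_{v′}^δ equals −2(n − Δ(v,v′)) − 2cos(δ)·Δ(v,v′), where Δ(v,v′) is the Hamming distance between v and v′. Consequently, the minimum over unit vectors ψ ∈ ℂ^{2ⁿ} of (⟨ψ, H_v^δ ψ⟩ + n) + (⟨ψ, H_{v′}^δ ψ⟩ + n) equals 2·Δ(v,v′)·(1 − cos δ). -/

import Mathlib

open Matrix Real Finset

/-- Single-site Pauli X on qubit `i` of an `n`-qubit system. -/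
noncomputable def pauliX (n : ℕ) (i : Fin n) : Matrix (Fin n → Fin 2) (Fin n → Fin 2) ℂ :=
  fun f g => if f i ≠ g i ∧ ∀ j, j ≠ i → f j = g j then 1 else 0

/-- Single-site Pauli Z on qubit `i` of an `n`-qubit system. -/
noncomputable def pauliZ (n : ℕ) (i : Fin n) : Matrix (Fin n → Fin 2) (Fin n → Fin 2) ℂ :=
  fun f g => if f = g then (-1 : ℂ) ^ ((f i : ℕ)) else 0

/-- The objective observable `H_v^δ = -∑ᵢ [sin(π/4 + vᵢ δ) Xᵢ + cos(π/4 + vᵢ δ) Zᵢ]`. -/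
noncomputable def Ham (n : ℕ) (δ : ℝ) (v : Fin n → ℝ) :
    Matrix (Fin n → Fin 2) (Fin n → Fin 2) ℂ :=
  - ∑ i : Fin n, (((Real.sin (π/4 + v i * δ) : ℝ) : ℂ) • pauliX n i
      + ((Real.cos (π/4 + v i * δ) : ℝ) : ℂ) • pauliZ n i)

/-- The quadratic form `⟨ψ, M ψ⟩`, conjugate-linear in the first argument. -/
noncomputable def qform {m : Type*} [Fintype m] (M : Matrix m m ℂ) (ψ : m → ℂ) : ℂ :=
  star ψ ⬝ᵥ M.mulVec ψ

/-- The bit string `f` with bit `i` flipped. -/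
def flipBit {n : ℕ} (i : Fin n) (f : Fin n → Fin 2) : Fin n → Fin 2 :=
  Function.update f i (f i + 1)

theorem flipBit_apply_self {n : ℕ} (i : Fin n) (f : Fin n → Fin 2) :
    flipBit i f i = f i + 1 := by
  simp [flipBit]

theorem flipBit_flipBit {n : ℕ} (i : Fin n) (f : Fin n → Fin 2) :
    flipBit i (flipBit i f) = f := by
  have h : ∀ k : Fin 2, k + 1 + 1 = k := by decide
  simp [flipBit, h]

theorem pauliX_apply {n : ℕ} (i : Fin n) (f g : Fin n → Fin 2) :
    pauliX n i f g = if flipBit i f = g then 1 else 0 := by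
  have h : ∀ k l : Fin 2, k + 1 = l ↔ k ≠ l := by decide
  simp only [pauliX, flipBit, Function.update_eq_iff, h]

theorem pauliX_mulVec {n : ℕ} (i : Fin n) (ψ : (Fin n → Fin 2) → ℂ) (f : Fin n → Fin 2) :
    (pauliX n i *ᵥ ψ) f = ψ (flipBit i f) := by
  simp [mulVec, dotProduct, pauliX_apply]

theorem pauliZ_mulVec {n : ℕ} (i : Fin n) (ψ : (Fin n → Fin 2) → ℂ) (f : Fin n → Fin 2) :
    (pauliZ n i *ᵥ ψ) f = (-1) ^ (f i : ℕ) * ψ f := by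
  simp [mulVec, dotProduct, pauliZ]

theorem pauliX_isHermitian {n : ℕ} (i : Fin n) : (pauliX n i).IsHermitian := by
  ext f g
  have h : flipBit i g = f ↔ flipBit i f = g :=
    ⟨fun h => by rw [← h, flipBit_flipBit], fun h => by rw [← h, flipBit_flipBit]⟩
  simp [conjTranspose_apply, pauliX_apply, h, apply_ite (starRingEnd ℂ)]

theorem pauliZ_isHermitian {n : ℕ} (i : Fin n) : (pauliZ n i).IsHermitian := by
  ext f g
  by_cases h : f = g
  · simp [conjTranspose_apply, pauliZ, h]
  · simp [conjTranspose_apply, pauliZ, h, Ne.symm h]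

/-- The spin observable `sin θ Xᵢ + cos θ Zᵢ` on qubit `i`. -/
noncomputable def spin (n : ℕ) (i : Fin n) (θ : ℝ) :
    Matrix (Fin n → Fin 2) (Fin n → Fin 2) ℂ :=
  ((Real.sin θ : ℝ) : ℂ) • pauliX n i + ((Real.cos θ : ℝ) : ℂ) • pauliZ n i

theorem spin_mulVec {n : ℕ} (i : Fin n) (θ : ℝ) (ψ : (Fin n → Fin 2) → ℂ)
    (f : Fin n → Fin 2) :
    (spin n i θ *ᵥ ψ) f = (Real.sin θ : ℂ) * ψ (flipBit i f)
      + (Real.cos θ : ℂ) * ((-1) ^ (f i : ℕ) * ψ f) := by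
  simp only [spin, add_mulVec, smul_mulVec, Pi.add_apply, Pi.smul_apply, smul_eq_mul,
    pauliX_mulVec, pauliZ_mulVec]

theorem spin_isHermitian {n : ℕ} (i : Fin n) (θ : ℝ) : (spin n i θ).IsHermitian := by
  simp only [IsHermitian, spin, conjTranspose_add, conjTranspose_smul,
    (pauliX_isHermitian i).eq, (pauliZ_isHermitian i).eq, Complex.star_def, Complex.conj_ofReal]

theorem spin_mulVec_spin_mulVec {n : ℕ} (i : Fin n) (θ : ℝ) (ψ : (Fin n → Fin 2) → ℂ) :
    spin n i θ *ᵥ (spin n i θ *ᵥ ψ) = ψ := by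
  have hθ : (Real.sin θ : ℂ) ^ 2 + (Real.cos θ : ℂ) ^ 2 = 1 := by
    exact_mod_cast Real.sin_sq_add_cos_sq θ
  ext f
  simp only [spin_mulVec, flipBit_flipBit, flipBit_apply_self]
  generalize f i = k
  fin_cases k <;> simp only [Fin.zero_eta, Fin.mk_one, Fin.isValue, zero_add, Fin.val_zero,
    Fin.val_one, show (1 + 1 : Fin 2) = 0 from rfl, pow_zero, pow_one] <;> linear_combination ψ f * hθ

open scoped ComplexOrder in
/-- The expectation of a Hermitian involution in a unit vector is at most one. -/
theorem qform_re_le_one {m : Type*} [Fintype m] {M : Matrix m m ℂ} (hM : M.IsHermitian)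
    {ψ : m → ℂ} (hMM : M *ᵥ (M *ᵥ ψ) = ψ) (hψ : star ψ ⬝ᵥ ψ = 1) : (qform M ψ).re ≤ 1 := by
  have hstar : star (M *ᵥ ψ) = star ψ ᵥ* M := by rw [star_mulVec, hM.eq]
  have h0 : 0 ≤ star (ψ - M *ᵥ ψ) ⬝ᵥ (ψ - M *ᵥ ψ) := dotProduct_star_self_nonneg _
  have h1 : star (ψ - M *ᵥ ψ) ⬝ᵥ (ψ - M *ᵥ ψ) = 2 - 2 * qform M ψ := by
    rw [star_sub, hstar, sub_dotProduct, dotProduct_sub, dotProduct_sub,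
      ← dotProduct_mulVec, ← dotProduct_mulVec, hMM, hψ, qform]
    ring
  rw [h1] at h0
  have h2 := (Complex.le_def.mp h0).1
  simp at h2
  linarith

theorem qform_add {m : Type*} [Fintype m] (M N : Matrix m m ℂ) (ψ : m → ℂ) :
    qform (M + N) ψ = qform M ψ + qform N ψ := by
  simp only [qform, add_mulVec, dotProduct_add]

theorem qform_neg_sum_smul_re {m ι : Type*} [Fintype m] [Fintype ι] (c : ι → ℝ)
    (A : ι → Matrix m m ℂ) (ψ : m → ℂ) :
    (qform (-∑ i, (c i : ℂ) • A i) ψ).re = -∑ i, c i * (qform (A i) ψ).re := by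
  simp only [qform, neg_mulVec, sum_mulVec, smul_mulVec, dotProduct_neg, dotProduct_sum,
    dotProduct_smul, smul_eq_mul, Complex.neg_re, Complex.re_sum, Complex.re_ofReal_mul]

/-- The amplitudes of the qubit state whose spin points in direction `θ`. -/
noncomputable def spinAmplitude (θ : ℝ) (k : Fin 2) : ℝ :=
  if k = 0 then Real.cos (θ / 2) else Real.sin (θ / 2)

theorem spinAmplitude_eigen (θ : ℝ) (k : Fin 2) :
    Real.sin θ * spinAmplitude θ (k + 1) + Real.cos θ * ((-1) ^ (k : ℕ) * spinAmplitude θ k)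
      = spinAmplitude θ k := by
  have hs : Real.sin θ = 2 * Real.sin (θ / 2) * Real.cos (θ / 2) := by
    rw [← Real.sin_two_mul]; ring_nf
  have hc : Real.cos θ = Real.cos (θ / 2) ^ 2 - Real.sin (θ / 2) ^ 2 := by
    rw [← Real.cos_two_mul']; ring_nf
  have h1 := Real.sin_sq_add_cos_sq (θ / 2)
  rw [hs, hc]
  fin_cases k
  · simp [spinAmplitude]
    linear_combination Real.cos (θ / 2) * h1
  · simp [spinAmplitude]
    linear_combination Real.sin (θ / 2) * h1

/-- The product state in which qubit `i` has its spin in direction `θ i`. -/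
noncomputable def spinState {n : ℕ} (θ : Fin n → ℝ) (f : Fin n → Fin 2) : ℂ :=
  ((∏ i, spinAmplitude (θ i) (f i) : ℝ) : ℂ)

theorem star_spinState_dotProduct {n : ℕ} (θ : Fin n → ℝ) :
    star (spinState θ) ⬝ᵥ spinState θ = 1 := by
  have h : ∑ f : Fin n → Fin 2, ∏ i, spinAmplitude (θ i) (f i) ^ 2 = 1 := by
    rw [← Fintype.prod_sum fun i k => spinAmplitude (θ i) k ^ 2]
    simp [spinAmplitude]
  simp only [dotProduct, Pi.star_apply, spinState, Complex.star_def, Complex.conj_ofReal]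
  rw [← Complex.ofReal_one, ← h]
  push_cast
  exact Finset.sum_congr rfl fun f _ => by rw [Finset.prod_pow, sq]

theorem spin_mulVec_spinState {n : ℕ} (θ : Fin n → ℝ) (i : Fin n) :
    spin n i (θ i) *ᵥ spinState θ = spinState θ := by
  ext f
  have hflip : ∏ j ∈ univ.erase i, spinAmplitude (θ j) (flipBit i f j)
      = ∏ j ∈ univ.erase i, spinAmplitude (θ j) (f j) :=
    Finset.prod_congr rfl fun j hj => by
      rw [flipBit, Function.update_of_ne (Finset.ne_of_mem_erase hj)]
  have h := congrArg Complex.ofReal (spinAmplitude_eigen (θ i) (f i))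
  simp only [spin_mulVec, spinState]
  rw [← Finset.mul_prod_erase univ _ (Finset.mem_univ i),
    ← Finset.mul_prod_erase univ (fun j => spinAmplitude (θ j) (f j)) (Finset.mem_univ i),
    hflip, flipBit_apply_self]
  push_cast at h ⊢
  linear_combination (∏ j ∈ univ.erase i, (spinAmplitude (θ j) (f j) : ℂ)) * h

theorem qform_spin_spinState {n : ℕ} (θ : Fin n → ℝ) (i : Fin n) :
    qform (spin n i (θ i)) (spinState θ) = 1 := by
  rw [qform, spin_mulVec_spinState, star_spinState_dotProduct]

/-- The ground state energy of noninteracting spins is minus the sum of the field strengths. -/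
theorem isLeast_qform_neg_sum_spin {n : ℕ} {c : Fin n → ℝ} (hc : ∀ i, 0 ≤ c i)
    (θ : Fin n → ℝ) :
    IsLeast {x : ℝ | ∃ ψ : (Fin n → Fin 2) → ℂ, star ψ ⬝ᵥ ψ = 1 ∧
      x = (qform (-∑ i, (c i : ℂ) • spin n i (θ i)) ψ).re} (-∑ i, c i) := by
  refine ⟨⟨spinState θ, star_spinState_dotProduct θ, ?_⟩, ?_⟩
  · rw [qform_neg_sum_smul_re]
    simp [qform_spin_spinState]
  · rintro _ ⟨ψ, hψ, rfl⟩
    rw [qform_neg_sum_smul_re]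
    exact neg_le_neg (Finset.sum_le_sum fun i _ => mul_le_of_le_one_right (hc i)
      (qform_re_le_one (spin_isHermitian i _) (spin_mulVec_spin_mulVec i _ ψ) hψ))

theorem Ham_add_Ham {n : ℕ} {δ : ℝ} {v v' : Fin n → ℝ}
    (hv : ∀ i, v i = 1 ∨ v i = -1) (hv' : ∀ i, v' i = 1 ∨ v' i = -1) :
    Ham n δ v + Ham n δ v' =
      -∑ i, ((if v i ≠ v' i then 2 * Real.cos δ else 2 : ℝ) : ℂ) •
        spin n i (if v i ≠ v' i then π / 4 else π / 4 + v i * δ) := by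
  rw [Ham, Ham, ← neg_add, ← Finset.sum_add_distrib]
  congr 1
  refine Finset.sum_congr rfl fun i _ => ?_
  by_cases h : v i = v' i
  · simp only [h, ne_eq, not_true_eq_false, if_false, spin]
    push_cast
    module
  · have hneg : v' i = -v i := by
      rcases hv i with h1 | h1 <;> rcases hv' i with h2 | h2 <;> simp_all
    have hcos : Real.cos (v i * δ) = Real.cos δ := by
      rcases hv i with h1 | h1 <;> simp [h1]
    have hsum : ∀ a b c d : ℝ, a + c = 2 * Real.cos δ * Real.sin (π / 4) →
        b + d = 2 * Real.cos δ * Real.cos (π / 4) →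
        ((a : ℂ) • pauliX n i + (b : ℂ) • pauliZ n i)
          + ((c : ℂ) • pauliX n i + (d : ℂ) • pauliZ n i)
          = ((2 * Real.cos δ : ℝ) : ℂ) • spin n i (π / 4) := by
      intro a b c d h1 h2
      rw [spin, smul_add, smul_smul, smul_smul, ← Complex.ofReal_mul, ← Complex.ofReal_mul,
        ← h1, ← h2]
      push_cast
      module
    simp only [ne_eq, h, not_false_eq_true, if_true]
    apply hsum
    · rw [hneg, Real.sin_add, neg_mul, Real.sin_add, Real.cos_neg, Real.sin_neg, hcos]
      ring
    · rw [hneg, Real.cos_add, neg_mul, Real.cos_add, Real.cos_neg, Real.sin_neg, hcos]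
      ring

theorem sum_ite_ne_eq_hammingDist {n : ℕ} (v v' : Fin n → ℝ) (a b : ℝ) :
    ∑ i, (if v i ≠ v' i then a else b)
      = hammingDist v v' * a + (n - hammingDist v v') * b := by
  have h : ∀ i, (if v i ≠ v' i then a else b) = (if v i ≠ v' i then 1 else 0) * (a - b) + b := by
    intro i
    split_ifs <;> ring
  rw [Finset.sum_congr rfl fun i _ => h i, Finset.sum_add_distrib, ← Finset.sum_mul,
    Finset.sum_boole, Finset.sum_const, Finset.card_univ, Fintype.card_fin, nsmul_eq_mul,
    hammingDist]
  ring

/-- For `n ≥ 1`, `0 ≤ δ < π/2` and `v, v' ∈ {-1,1}ⁿ`, the smallest eigenvalue of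
`H_v^δ + H_{v'}^δ` equals `-2(n - Δ(v,v')) - 2 cos δ · Δ(v,v')`, and consequently the
minimum over unit vectors `ψ` of `(⟨ψ,H_v^δψ⟩ + n) + (⟨ψ,H_{v'}^δψ⟩ + n)` equals
`2 Δ(v,v') (1 - cos δ)`, where `Δ` is the Hamming distance. -/
theorem smallest_eigenvalue_Ham_add (n : ℕ) (hn : 1 ≤ n) (δ : ℝ) (hδ0 : 0 ≤ δ)
    (hδ : δ < π / 2) (v v' : Fin n → ℝ)
    (hv : ∀ i, v i = 1 ∨ v i = -1) (hv' : ∀ i, v' i = 1 ∨ v' i = -1) :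
    IsLeast {x : ℝ | ∃ ψ : (Fin n → Fin 2) → ℂ, star ψ ⬝ᵥ ψ = 1 ∧
        x = (qform (Ham n δ v + Ham n δ v') ψ).re}
      (-2 * ((n : ℝ) - hammingDist v v') - 2 * Real.cos δ * hammingDist v v') ∧
    IsLeast {x : ℝ | ∃ ψ : (Fin n → Fin 2) → ℂ, star ψ ⬝ᵥ ψ = 1 ∧
        x = ((qform (Ham n δ v) ψ).re + n) + ((qform (Ham n δ v') ψ).re + n)}
      (2 * (hammingDist v v' : ℝ) * (1 - Real.cos δ)) := by
  have hcos : 0 ≤ Real.cos δ := Real.cos_nonneg_of_mem_Icc ⟨by linarith, hδ.le⟩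
  have h : IsLeast {x : ℝ | ∃ ψ : (Fin n → Fin 2) → ℂ, star ψ ⬝ᵥ ψ = 1 ∧
        x = (qform (Ham n δ v + Ham n δ v') ψ).re}
      (-2 * ((n : ℝ) - hammingDist v v') - 2 * Real.cos δ * hammingDist v v') := by
    rw [Ham_add_Ham hv hv']
    convert isLeast_qform_neg_sum_spin (n := n)
      (c := fun i => if v i ≠ v' i then 2 * Real.cos δ else 2) ?_ _ using 1
    · rw [sum_ite_ne_eq_hammingDist]
      ring
    · intro i
      split_ifs <;> positivity
  refine ⟨h, ?_, ?_⟩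
  · obtain ⟨ψ, hψ, hx⟩ := h.1
    rw [qform_add, Complex.add_re] at hx
    exact ⟨ψ, hψ, by linarith⟩
  · rintro _ ⟨ψ, hψ, rfl⟩
    have hx := h.2 ⟨ψ, hψ, rfl⟩
    rw [qform_add, Complex.add_re] at hx
    linarith
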